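/- arXiv:1103.4531 — 2 statements merged into one kernel-verified Lean document; each statement's English description precedes it below -/
import Mathlib

section
/- Let δ : U → ℝ be a smooth strictly positive function on an open set U ⊆ ℝ^l, let f : U → ℝ be smooth, and let γ ∈ ℝ. If Δf − ⟨∇(log δ), ∇f⟩ = γ·f holds on U, then the function ψ : ℝ × U → ℝ defined by ψ(t,x) := e^{γt/2}·δ(x)^{-1/2}·f(x) satisfies ∂ψ/∂t (t,x) = (1/2)·( Δ_x ψ(t,x) − δ(x)^{1/2}·Δ(δ^{-1/2})(x)·ψ(t,x) ) for all (t,x) ∈ ℝ × U; i.e. ψ is a stationary solution of the reduced diffusion equation obtained at the zero coadjoint orbit. -/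
open scoped BigOperators RealInnerProductSpace

/-- Euclidean Laplacian: sum of second partial derivatives. -/
noncomputable def eLap {l : ℕ} (f : EuclideanSpace ℝ (Fin l) → ℝ)
    (x : EuclideanSpace ℝ (Fin l)) : ℝ :=
  ∑ i, fderiv ℝ (fun y => fderiv ℝ f y (EuclideanSpace.single i 1)) x
    (EuclideanSpace.single i 1)

/-- The Euclidean inner product of two gradients, in terms of partial derivatives. -/
theorem inner_gradient_eq_sum {l : ℕ} (g f : EuclideanSpace ℝ (Fin l) → ℝ)
    (x : EuclideanSpace ℝ (Fin l)) :
    ⟪gradient g x, gradient f x⟫ =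
      ∑ i, fderiv ℝ g x (EuclideanSpace.single i 1) * fderiv ℝ f x (EuclideanSpace.single i 1) := by
  have key (h : EuclideanSpace ℝ (Fin l) → ℝ) (i : Fin l) :
      gradient h x i = fderiv ℝ h x (EuclideanSpace.single i 1) := by
    rw [gradient, ← InnerProductSpace.toDual_symm_apply, EuclideanSpace.inner_single_right]
    simp
  rw [PiLp.inner_apply]
  refine Finset.sum_congr rfl fun i _ => ?_
  rw [key, key]
  simp [mul_comm]

theorem ContDiffAt.differentiableAt_fderiv_apply {E : Type*} [NormedAddCommGroup E]
    [NormedSpace ℝ E] {f : E → ℝ} {x : E} (hf : ContDiffAt ℝ 2 f x) (v : E) :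
    DifferentiableAt ℝ (fun y => fderiv ℝ f y v) x :=
  ((hf.fderiv_right (m := 1) (by norm_num)).differentiableAt (by norm_num)).clm_apply
    (differentiableAt_const v)

/-- The product rule for the Euclidean Laplacian. -/
theorem eLap_mul {l : ℕ} {g f : EuclideanSpace ℝ (Fin l) → ℝ} {x : EuclideanSpace ℝ (Fin l)}
    (hg : ContDiffAt ℝ 2 g x) (hf : ContDiffAt ℝ 2 f x) :
    eLap (fun y => g y * f y) x =
      g x * eLap f x + 2 * ⟪gradient g x, gradient f x⟫ + f x * eLap g x := by
  rw [inner_gradient_eq_sum]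
  simp only [eLap, Finset.mul_sum, ← Finset.sum_add_distrib]
  refine Finset.sum_congr rfl fun i _ => ?_
  set v : EuclideanSpace ℝ (Fin l) := EuclideanSpace.single i 1
  have hev : (fun y => fderiv ℝ (fun y => g y * f y) y v) =ᶠ[nhds x]
      fun y => g y * fderiv ℝ f y v + f y * fderiv ℝ g y v := by
    filter_upwards [hg.eventually (by norm_num), hf.eventually (by norm_num)] with y hgy hfy
    rw [fderiv_fun_mul (hgy.differentiableAt (by norm_num)) (hfy.differentiableAt (by norm_num))]
    simp
  have hg1 := hg.differentiableAt (by norm_num)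
  have hf1 := hf.differentiableAt (by norm_num)
  have hg2 := hg.differentiableAt_fderiv_apply v
  have hf2 := hf.differentiableAt_fderiv_apply v
  rw [hev.fderiv_eq, fderiv_fun_add (hg1.fun_mul hf2) (hf1.fun_mul hg2), fderiv_fun_mul hg1 hf2,
    fderiv_fun_mul hf1 hg2]
  simp only [add_apply, smul_apply, smul_eq_mul]
  ring

theorem eLap_const_mul {l : ℕ} {f : EuclideanSpace ℝ (Fin l) → ℝ}
    {x : EuclideanSpace ℝ (Fin l)} (c : ℝ) (hf : ContDiffAt ℝ 2 f x) :
    eLap (fun y => c * f y) x = c * eLap f x := by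
  rw [eLap_mul contDiffAt_const hf, inner_gradient_eq_sum]
  simp [eLap]

/-- The logarithmic-derivative form of the chain rule for a real power. -/
theorem fderiv_rpow_const_eq_log {E : Type*} [NormedAddCommGroup E] [NormedSpace ℝ E]
    {δ : E → ℝ} {x : E} (hδ : DifferentiableAt ℝ δ x) (hpos : 0 < δ x) (p : ℝ) :
    fderiv ℝ (fun y => δ y ^ p) x =
      (p * δ x ^ p) • fderiv ℝ (fun y => Real.log (δ y)) x := by
  rw [(hδ.hasFDerivAt.rpow_const (Or.inl hpos.ne')).fderiv,
    (hδ.hasFDerivAt.log hpos.ne').fderiv, smul_smul, Real.rpow_sub_one hpos.ne']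
  congr 1
  ring

/-- If `f` is an eigenfunction of `Δ - ⟨∇ log δ, ∇·⟩` with eigenvalue `γ`, then
`ψ(t,x) = e^{γt/2} δ(x)^{-1/2} f(x)` is a stationary solution of the reduced diffusion
equation (equation (H1) of the paper at the zero coadjoint orbit):
`∂ψ/∂t = (1/2)(Δψ - δ^{1/2} Δ(δ^{-1/2}) ψ)`. -/
theorem stmt5 {l : ℕ} (U : Set (EuclideanSpace ℝ (Fin l))) (hU : IsOpen U)
    (δ : EuclideanSpace ℝ (Fin l) → ℝ) (hδ : ContDiffOn ℝ (⊤ : ℕ∞) δ U)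
    (hδpos : ∀ x ∈ U, 0 < δ x)
    (f : EuclideanSpace ℝ (Fin l) → ℝ) (hf : ContDiffOn ℝ (⊤ : ℕ∞) f U) (γ : ℝ)
    (heig : ∀ x ∈ U,
      eLap f x - ⟪gradient (fun y => Real.log (δ y)) x, gradient f x⟫ = γ * f x)
    (ψ : ℝ → EuclideanSpace ℝ (Fin l) → ℝ)
    (hψ : ψ = fun t x => Real.exp (γ * t / 2) * (δ x) ^ (-(1:ℝ)/2) * f x) :
    ∀ t : ℝ, ∀ x ∈ U,
      deriv (fun s => ψ s x) t
        = (1/2 : ℝ) * (eLap (fun y => ψ t y) x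
            - (δ x) ^ ((1:ℝ)/2) * eLap (fun y => (δ y) ^ (-(1:ℝ)/2)) x * ψ t x) := by
  intro t x hx
  subst hψ
  have hpos := hδpos x hx
  have hδx : ContDiffAt ℝ 2 δ x := (hδ.contDiffAt (hU.mem_nhds hx)).of_le
    (WithTop.coe_le_coe.2 le_top)
  have hfx : ContDiffAt ℝ 2 f x := (hf.contDiffAt (hU.mem_nhds hx)).of_le
    (WithTop.coe_le_coe.2 le_top)
  have hg : ContDiffAt ℝ 2 (fun y => δ y ^ (-(1:ℝ)/2)) x := hδx.rpow_const_of_ne hpos.ne'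
  have hinner : ⟪gradient (fun y => δ y ^ (-(1:ℝ)/2)) x, gradient f x⟫ =
      -(1/2) * δ x ^ (-(1:ℝ)/2) * ⟪gradient (fun y => Real.log (δ y)) x, gradient f x⟫ := by
    rw [inner_gradient_eq_sum, inner_gradient_eq_sum, Finset.mul_sum,
      fderiv_rpow_const_eq_log (hδx.differentiableAt (by norm_num)) hpos]
    refine Finset.sum_congr rfl fun i _ => ?_
    simp only [smul_apply, smul_eq_mul]
    ring
  have hlap : eLap (fun y => Real.exp (γ * t / 2) * δ y ^ (-(1:ℝ)/2) * f y) x =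
      Real.exp (γ * t / 2) *
        (δ x ^ (-(1:ℝ)/2) * (γ * f x) + f x * eLap (fun y => δ y ^ (-(1:ℝ)/2)) x) := by
    simp only [mul_assoc]
    rw [eLap_const_mul _ (hg.mul hfx), eLap_mul hg hfx, hinner, ← heig x hx]
    ring
  have hcancel : δ x ^ ((1:ℝ)/2) * δ x ^ (-(1:ℝ)/2) = 1 := by
    rw [← Real.rpow_add hpos]
    norm_num
  have hderiv : HasDerivAt (fun s => Real.exp (γ * s / 2) * δ x ^ (-(1:ℝ)/2) * f x)
      (Real.exp (γ * t / 2) * (γ * 1 / 2) * δ x ^ (-(1:ℝ)/2) * f x) t :=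
    (((((hasDerivAt_id t).const_mul γ).div_const 2).exp).mul_const _).mul_const _
  rw [hderiv.deriv, hlap]
  linear_combination (1/2 * Real.exp (γ * t / 2) * f x *
    eLap (fun y => δ y ^ (-(1:ℝ)/2)) x) * hcancel
end

section
/- Let l ≥ 2, let C = {x ∈ ℝ^l : x_1 > x_2 > ⋯ > x_l} be the open Weyl chamber, let m ∈ ℝ, and define u : C → ℝ by u(x) = ∏_{1≤i<j≤l} (x_i − x_j)^m. Then u is smooth on C and satisfies Δu(x) = 2m(m−1)·( Σ_{1≤i<j≤l} 1/(x_i − x_j)² )·u(x) for all x ∈ C. Equivalently, with δ := u², one has (1/2)·δ^{-1/2}·Δ(δ^{1/2}) = m(m−1)·Σ_{1≤i<j≤l} (x_i − x_j)^{-2} on C. -/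
open scoped BigOperators

/-- The open Weyl chamber `{x ∈ ℝ^l : x₁ > x₂ > ⋯ > x_l}`. -/
def chamber (l : ℕ) : Set (EuclideanSpace ℝ (Fin l)) :=
  {x | ∀ i j : Fin l, i < j → x j < x i}

open Finset in
/-- A sum over all ordered pairs of a function vanishing on the diagonal, folded onto the pairs
`a < b`. -/
theorem sum_sum_eq_sum_lt_add_swap {l : ℕ} (f : Fin l → Fin l → ℝ) (hf : ∀ a, f a a = 0) :
    ∑ a, ∑ b, f a b
      = ∑ p ∈ univ.filter (fun p : Fin l × Fin l => p.1 < p.2), (f p.1 p.2 + f p.2 p.1) := by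
  have hswap : ∑ p ∈ univ.filter (fun p : Fin l × Fin l => p.1 < p.2), f p.2 p.1
      = ∑ p ∈ univ.filter (fun p : Fin l × Fin l => p.2 < p.1), f p.1 p.2 :=
    sum_nbij' Prod.swap Prod.swap (by simp) (by simp) (by simp) (by simp) (by simp)
  rw [sum_add_distrib, hswap, sum_filter, sum_filter, ← sum_add_distrib, ← Fintype.sum_prod_type']
  refine sum_congr rfl fun p _ => ?_
  rcases lt_trichotomy p.1 p.2 with h | h | h
  · simp [h, h.not_gt]
  · simp [h, hf]
  · simp [h, h.not_gt]

/-- The cross terms in `∑ i, (∑ j, 1 / (x i - x j)) ^ 2` cancel. -/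
theorem sum_sq_sum_inv_sub {ι : Type*} [Fintype ι] {x : ι → ℝ} (hx : Function.Injective x) :
    ∑ i, (∑ j, (x i - x j)⁻¹) ^ 2 = ∑ i, ∑ j, ((x i - x j)⁻¹) ^ 2 := by
  classical
  let g : ι → ι → ι → ℝ := fun i j k =>
    (x i - x j)⁻¹ * (x i - x k)⁻¹ - if j = k then ((x i - x j)⁻¹) ^ 2 else 0
  have hg : ∀ i j k, g i j k + g j k i + g k i j = 0 := by
    intro i j k
    by_cases hij : i = j
    · subst hij
      by_cases hik : i = k
      · subst hik; simp [g]
      · simp [g, hik, Ne.symm hik, sq]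
    by_cases hik : i = k
    · subst hik; simp [g, hij, Ne.symm hij, sq]
    by_cases hjk : j = k
    · subst hjk; simp [g, hij, Ne.symm hij, sq]
    have h1 := sub_ne_zero.2 (hx.ne hij)
    have h2 := sub_ne_zero.2 (hx.ne hik)
    have h3 := sub_ne_zero.2 (hx.ne hjk)
    have h1' := sub_ne_zero.2 (hx.ne (Ne.symm hij))
    have h2' := sub_ne_zero.2 (hx.ne (Ne.symm hik))
    have h3' := sub_ne_zero.2 (hx.ne (Ne.symm hjk))
    simp only [g, hij, Ne.symm hik, hjk, if_false]
    field_simp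
    ring
  have hrot : ∑ i, ∑ j, ∑ k, g j k i = ∑ i, ∑ j, ∑ k, g i j k := by
    rw [Finset.sum_comm]
    exact Finset.sum_congr rfl fun j _ => Finset.sum_comm
  have hrot' : ∑ i, ∑ j, ∑ k, g k i j = ∑ i, ∑ j, ∑ k, g i j k := by
    rw [Finset.sum_congr rfl fun i _ => Finset.sum_comm, Finset.sum_comm]
  have hzero : ∑ i, ∑ j, ∑ k, g i j k = 0 := by
    have h : ∑ i, ∑ j, ∑ k, (g i j k + g j k i + g k i j) = 0 := by simp [hg]
    simp only [Finset.sum_add_distrib] at h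
    linarith
  have hexp : ∑ i, ∑ j, ∑ k, g i j k
      = ∑ i, (∑ j, (x i - x j)⁻¹) ^ 2 - ∑ i, ∑ j, ((x i - x j)⁻¹) ^ 2 := by
    simp [g, Finset.sum_sub_distrib, sq, Finset.sum_mul_sum]
  linarith

/-- The root `x ↦ x p.1 - x p.2` as a continuous linear functional. -/
noncomputable def rootCLM {l : ℕ} (p : Fin l × Fin l) : EuclideanSpace ℝ (Fin l) →L[ℝ] ℝ :=
  EuclideanSpace.proj p.1 - EuclideanSpace.proj p.2

theorem rootCLM_apply {l : ℕ} (p : Fin l × Fin l) (x : EuclideanSpace ℝ (Fin l)) :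
    rootCLM p x = x p.1 - x p.2 := by
  simp [rootCLM]

theorem rootCLM_single {l : ℕ} (p : Fin l × Fin l) (i : Fin l) :
    rootCLM p (EuclideanSpace.single i 1)
      = (if p.1 = i then 1 else 0) - (if p.2 = i then 1 else 0) := by
  simp [rootCLM_apply]

theorem injective_of_mem_chamber {l : ℕ} {x : EuclideanSpace ℝ (Fin l)} (hx : x ∈ chamber l) :
    Function.Injective x :=
  StrictAnti.injective fun i j hij => hx i j hij

section ProductOfPowers

variable {E ι : Type*} [NormedAddCommGroup E] [NormedSpace ℝ E]

/-- Gradient of a product of powers of linear functionals. -/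
theorem hasFDerivAt_prod_rpow (s : Finset ι) (L : ι → E →L[ℝ] ℝ) (m : ℝ) {x : E}
    (hx : ∀ p ∈ s, 0 < L p x) :
    HasFDerivAt (fun y => ∏ p ∈ s, L p y ^ m)
      ((∏ p ∈ s, L p x ^ m) • m • ∑ p ∈ s, (L p x)⁻¹ • L p) x := by
  have hform : ∀ y, (∀ p ∈ s, 0 < L p y) →
      ∏ p ∈ s, L p y ^ m = Real.exp (m * ∑ p ∈ s, Real.log (L p y)) := by
    intro y hy
    rw [Finset.mul_sum, Real.exp_sum]
    refine Finset.prod_congr rfl fun p hp => ?_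
    rw [Real.rpow_def_of_pos (hy p hp), mul_comm]
  have hpos : ∀ᶠ y in nhds x, ∀ p ∈ s, 0 < L p y :=
    (Finset.eventually_all s).2 fun p hp =>
      (L p).continuous.continuousAt.eventually (lt_mem_nhds (hx p hp))
  rw [hform x hx]
  refine HasFDerivAt.congr_of_eventuallyEq ?_ (hpos.mono hform)
  exact ((HasFDerivAt.fun_sum fun p hp =>
    ((L p).hasFDerivAt.log (hx p hp).ne')).const_mul m).exp

/-- Second derivative of a product of powers of linear functionals in a direction `v`. -/
theorem fderiv_fderiv_prod_rpow (s : Finset ι) (L : ι → E →L[ℝ] ℝ) (m : ℝ) {x : E}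
    (hx : ∀ p ∈ s, 0 < L p x) (v : E) :
    fderiv ℝ (fun y => fderiv ℝ (fun z => ∏ p ∈ s, L p z ^ m) y v) x v
      = (m ^ 2 * (∑ p ∈ s, (L p x)⁻¹ * L p v) ^ 2 - m * ∑ p ∈ s, ((L p x)⁻¹ * L p v) ^ 2)
        * ∏ p ∈ s, L p x ^ m := by
  have hpos : ∀ᶠ y in nhds x, ∀ p ∈ s, 0 < L p y :=
    (Finset.eventually_all s).2 fun p hp =>
      (L p).continuous.continuousAt.eventually (lt_mem_nhds (hx p hp))
  have heq : (fun y => fderiv ℝ (fun z => ∏ p ∈ s, L p z ^ m) y v) =ᶠ[nhds x]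
      fun y => (∏ p ∈ s, L p y ^ m) * (m * ∑ p ∈ s, (L p y)⁻¹ * L p v) := by
    filter_upwards [hpos] with y hy
    simp [(hasFDerivAt_prod_rpow s L m hy).fderiv]
  have hinv : HasFDerivAt (fun y => ∑ p ∈ s, (L p y)⁻¹ * L p v)
      (∑ p ∈ s, L p v • (-(L p x ^ 2)⁻¹) • L p) x :=
    HasFDerivAt.fun_sum fun p hp =>
      ((hasDerivAt_inv (hx p hp).ne').comp_hasFDerivAt x (L p).hasFDerivAt).mul_const (L p v)
  rw [heq.fderiv_eq, ((hasFDerivAt_prod_rpow s L m hx).fun_mul (hinv.const_mul m)).fderiv]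
  have hsum : ∑ p ∈ s, L p v * ((L p x ^ 2)⁻¹ * L p v) = ∑ p ∈ s, ((L p x)⁻¹ * L p v) ^ 2 :=
    Finset.sum_congr rfl fun p _ => by rw [mul_pow, inv_pow]; ring
  simp [hsum]
  ring

end ProductOfPowers

/-- **Olshanetsky–Perelomov formula (A-type).** For `u(x) = ∏_{i<j}(x_i - x_j)^m` on the
open Weyl chamber, `u` is smooth and `Δu = 2m(m-1)(∑_{i<j} (x_i - x_j)^{-2}) u`;
equivalently, with `δ = u²`, `(1/2)δ^{-1/2}Δδ^{1/2} = m(m-1)∑_{i<j}(x_i - x_j)^{-2}`. -/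
theorem stmt9 {l : ℕ} (hl : 2 ≤ l) (m : ℝ)
    (u : EuclideanSpace ℝ (Fin l) → ℝ)
    (hu : u = fun x => ∏ p ∈ Finset.univ.filter (fun p : Fin l × Fin l => p.1 < p.2),
      (x p.1 - x p.2) ^ m) :
    ContDiffOn ℝ (⊤ : ℕ∞) u (chamber l) ∧
    ∀ x ∈ chamber l,
      eLap u x
        = 2 * m * (m - 1)
            * (∑ p ∈ Finset.univ.filter (fun p : Fin l × Fin l => p.1 < p.2),
                1 / (x p.1 - x p.2) ^ 2) * u x := by
  have hpos : ∀ x ∈ chamber l, ∀ p ∈ Finset.univ.filter (fun p : Fin l × Fin l => p.1 < p.2),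
      0 < rootCLM p x := by
    intro x hx p hp
    rw [rootCLM_apply]
    exact sub_pos.2 (hx _ _ (Finset.mem_filter.1 hp).2)
  simp only [← rootCLM_apply] at hu ⊢
  subst hu
  refine ⟨contDiffOn_prod fun p hp => ?_, fun x hx => ?_⟩
  · exact (rootCLM p).contDiff.contDiffOn.rpow_const_of_ne fun x hx => (hpos x hx p hp).ne'
  simp only [eLap, fderiv_fderiv_prod_rpow _ _ m (hpos x hx)]
  rw [← Finset.sum_mul, Finset.sum_sub_distrib, ← Finset.mul_sum, ← Finset.mul_sum]
  have hgrad : ∀ i, ∑ p ∈ Finset.univ.filter (fun p : Fin l × Fin l => p.1 < p.2),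
      (rootCLM p x)⁻¹ * rootCLM p (EuclideanSpace.single i 1) = ∑ j, (x i - x j)⁻¹ := by
    intro i
    have h := sum_sum_eq_sum_lt_add_swap
      (fun a b => if a = i then (x a - x b)⁻¹ else 0) (by simp)
    have h' : ∑ a, ∑ b, (if a = i then (x a - x b)⁻¹ else 0) = ∑ j, (x i - x j)⁻¹ := by
      rw [Finset.sum_comm]
      simp
    rw [← h', h]
    refine Finset.sum_congr rfl fun p _ => ?_
    rw [rootCLM_single, rootCLM_apply, ← neg_sub (x p.1) (x p.2), inv_neg]
    split_ifs <;> ring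
  have hsq : ∑ i, ∑ j, ((x i - x j)⁻¹) ^ 2
      = 2 * ∑ p ∈ Finset.univ.filter (fun p : Fin l × Fin l => p.1 < p.2),
        1 / rootCLM p x ^ 2 := by
    rw [sum_sum_eq_sum_lt_add_swap _ (by simp), Finset.mul_sum]
    refine Finset.sum_congr rfl fun p _ => ?_
    rw [rootCLM_apply, ← neg_sub (x p.1) (x p.2), inv_neg, neg_sq, inv_pow, one_div]
    ring
  have hdiag : ∑ i, ∑ p ∈ Finset.univ.filter (fun p : Fin l × Fin l => p.1 < p.2),
      ((rootCLM p x)⁻¹ * rootCLM p (EuclideanSpace.single i 1)) ^ 2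
      = 2 * ∑ p ∈ Finset.univ.filter (fun p : Fin l × Fin l => p.1 < p.2),
        1 / rootCLM p x ^ 2 := by
    rw [Finset.sum_comm, Finset.mul_sum]
    refine Finset.sum_congr rfl fun p hp => ?_
    have hne : p.2 ≠ p.1 := (Finset.mem_filter.1 hp).2.ne'
    have hnorm : ∑ i, rootCLM p (EuclideanSpace.single i 1) ^ 2 = 2 := by
      have h : ∀ i, rootCLM p (EuclideanSpace.single i 1) ^ 2
          = (if p.1 = i then 1 else 0) + (if p.2 = i then 1 else 0) := by
        intro i
        rw [rootCLM_single]
        split_ifs with h1 h2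
        · exact absurd (h2.trans h1.symm) hne
        all_goals norm_num
      simp only [h, Finset.sum_add_distrib, Finset.sum_ite_eq, Finset.mem_univ, if_true]
      norm_num
    simp only [mul_pow]
    rw [← Finset.mul_sum, hnorm, inv_pow, one_div, mul_comm]
  simp only [hgrad]
  rw [sum_sq_sum_inv_sub (injective_of_mem_chamber hx), hsq, hdiag]
  ring
end
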